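/- Let {Y ∪ {Δ}, A, p} be an MDP model that is absorbing with a given initial state x0 and that satisfies Condition (S), and let Λ be a nonempty set of strategies. If the set D^Λ_{x0} of occupation measures over Λ is compact in M(Y × A) with respect to the w-topology, then the MDP model is Λ-uniformly absorbing with the initial state x0. -/

import Mathlib

open MeasureTheory ProbabilityTheory Filter Topology
open scoped ENNReal

noncomputable section

/-! ### General MDP framework

The state space of an absorbing-type MDP model is `X = Y ⊕ Unit`, where `Sum.inr ()` plays
the role of the isolated cemetery point `Δ` and `Y` is embedded via `Sum.inl`.

A history up to stage `n` is `h_n = (x_0, a_1, x_1, …, a_n, x_n)`, which we encode as the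
list of pairs `(x_k, a_{k+1})`, `k < n`, together with the last state `x_n`. -/

/-- The space `H_n` of histories up to stage `n`. -/
abbrev Hist (X A : Type*) (n : ℕ) : Type _ := (Fin n → X × A) × X

/-- A strategy: for every `n`, a stochastic (Markov) kernel on `A` given `H_n`,
prescribing the law of the action `a_{n+1}` given the history `h_n`. -/
def Strategy (X A : Type*) [MeasurableSpace X] [MeasurableSpace A] : Type _ :=
  {π : (n : ℕ) → Kernel (Hist X A n) A // ∀ n, IsMarkovKernel (π n)}

variable {X A Y : Type*} [MeasurableSpace X] [MeasurableSpace A] [MeasurableSpace Y]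

/-- The finite-dimensional distributions of the strategic measure `P^π_{x0}`:
`histLaw p π x0 n` is the joint law of `(X_0, A_1, …, A_n, X_n)` under `P^π_{x0}`,
built by the Ionescu-Tulcea recursion. -/
def histLaw (p : Kernel (X × A) X) (π : Strategy X A) (x0 : X) :
    (n : ℕ) → Measure (Hist X A n)
  | 0 => Measure.dirac (fun i => i.elim0, x0)
  | n + 1 =>
      (histLaw p π x0 n).bind fun h =>
        ((π.1 n) h).bind fun a =>
          (p (h.2, a)).map fun x' => (Fin.snoc h.1 (h.2, a), x')

/-- The law of the pair `(X_n, A_{n+1})` under the strategic measure `P^π_{x0}`. -/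
def pairLaw (p : Kernel (X × A) X) (π : Strategy X A) (x0 : X) (n : ℕ) :
    Measure (X × A) :=
  (histLaw p π x0 n).bind fun h => ((π.1 n) h).map fun a => (h.2, a)

/-- The occupation measure `η^π_{x0}` on `Y × A`:
`η^π_{x0}(dx × da) = Σ_n P^π_{x0}(X_n ∈ dx ∩ Y, A_{n+1} ∈ da)`. -/
def occupation (p : Kernel ((Y ⊕ Unit) × A) (Y ⊕ Unit)) (π : Strategy (Y ⊕ Unit) A)
    (x0 : Y ⊕ Unit) : Measure (Y × A) :=
  Measure.sum fun n => (pairLaw p π x0 n).comap fun ya : Y × A => (Sum.inl ya.1, ya.2)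

/-- `P^π_{x0}(X_t ∈ Y)`.  Since the cemetery `Δ` is absorbing, this equals the tail
probability `P^π_{x0}(τ > t)` of the hitting time `τ` of `Δ`. -/
def survive (p : Kernel ((Y ⊕ Unit) × A) (Y ⊕ Unit)) (π : Strategy (Y ⊕ Unit) A)
    (x0 : Y ⊕ Unit) (t : ℕ) : ℝ≥0∞ :=
  pairLaw p π x0 t {z | ∃ y : Y, z.1 = Sum.inl y}

/-- The model is absorbing with initial state `x0`:
`E^π_{x0}[τ] = Σ_t P^π_{x0}(τ > t) < ∞` for every strategy `π`. -/
def IsAbsorbing (p : Kernel ((Y ⊕ Unit) × A) (Y ⊕ Unit)) (x0 : Y ⊕ Unit) : Prop :=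
  ∀ π : Strategy (Y ⊕ Unit) A, ∑' t : ℕ, survive p π x0 t < ⊤

/-- The model is `Λ`-uniformly absorbing with initial state `x0`:
`sup_{π ∈ Λ} E^π_{x0}[Σ_{t=n}^∞ 1{τ > t}] = sup_{π ∈ Λ} Σ_{t ≥ n} P^π_{x0}(τ > t) → 0`. -/
def IsUnifAbsorbing (p : Kernel ((Y ⊕ Unit) × A) (Y ⊕ Unit))
    (Λ : Set (Strategy (Y ⊕ Unit) A)) (x0 : Y ⊕ Unit) : Prop :=
  Tendsto (fun n : ℕ => ⨆ π ∈ Λ, ∑' t : ℕ, survive p π x0 (n + t)) atTop (𝓝 0)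

/-- The set `D^Λ_{x0} ⊆ M(Y × A)` of occupation measures of strategies in `Λ`. -/
def OccSet (p : Kernel ((Y ⊕ Unit) × A) (Y ⊕ Unit)) (Λ : Set (Strategy (Y ⊕ Unit) A))
    (x0 : Y ⊕ Unit) : Set (FiniteMeasure (Y × A)) :=
  {η | ∃ π ∈ Λ, (η : Measure (Y × A)) = occupation p π x0}

/-- Condition (S): the action space is compact and `a ↦ ∫ g dp(·|x,a)` is continuous for
every bounded measurable `g` and every state `x`. -/
def ConditionS [TopologicalSpace A] (p : Kernel (X × A) X) : Prop :=
  CompactSpace A ∧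
    ∀ g : X → ℝ, Measurable g → (∃ C, ∀ x, |g x| ≤ C) →
      ∀ x : X, Continuous fun a : A => ∫ y, g y ∂(p (x, a))

/-- Condition (W): the action space is compact and `(x,a) ↦ ∫ g dp(·|x,a)` is continuous for
every bounded continuous `g`. -/
def ConditionW [TopologicalSpace X] [TopologicalSpace A] (p : Kernel (X × A) X) : Prop :=
  CompactSpace A ∧
    ∀ g : X → ℝ, Continuous g → (∃ C, ∀ x, |g x| ≤ C) →
      Continuous fun xa : X × A => ∫ y, g y ∂(p xa)

/-- The w-topology on `M(Ω)`: the coarsest topology making `η ↦ ∫ g dη` continuous for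
every bounded continuous `g : Ω → ℝ`. -/
def wTop (Ω : Type*) [TopologicalSpace Ω] [MeasurableSpace Ω] :
    TopologicalSpace (FiniteMeasure Ω) :=
  ⨅ (g : Ω → ℝ) (_ : Continuous g) (_ : ∃ C, ∀ z, |g z| ≤ C),
    TopologicalSpace.induced (fun η : FiniteMeasure Ω => ∫ z, g z ∂(η : Measure Ω))
      inferInstance

/-- The ws-topology on `M(Y × A)`: the coarsest topology making `η ↦ ∫ g dη` continuous for
every bounded Caratheodory function `g : Y × A → ℝ`. -/
def wsTop (Y A : Type*) [MeasurableSpace Y] [TopologicalSpace A] [MeasurableSpace A] :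
    TopologicalSpace (FiniteMeasure (Y × A)) :=
  ⨅ (g : Y × A → ℝ) (_ : Measurable g) (_ : ∃ C, ∀ z, |g z| ≤ C)
    (_ : ∀ y : Y, Continuous fun a : A => g (y, a)),
    TopologicalSpace.induced (fun η : FiniteMeasure (Y × A) => ∫ z, g z ∂(η : Measure (Y × A)))
      inferInstance

/-- The s-topology on `M(Y)`: the coarsest topology making `η ↦ ∫ f dη` continuous for
every bounded measurable `f : Y → ℝ`. -/
def sTop (Y : Type*) [MeasurableSpace Y] : TopologicalSpace (FiniteMeasure Y) :=
  ⨅ (f : Y → ℝ) (_ : Measurable f) (_ : ∃ C, ∀ z, |f z| ≤ C),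
    TopologicalSpace.induced (fun η : FiniteMeasure Y => ∫ z, f z ∂(η : Measure Y))
      inferInstance

open scoped NNReal BoundedContinuousFunction

/-- The curried form of a Carathéodory function is strongly measurable. -/
theorem stronglyMeasurable_curry_of_caratheodory {X A : Type*} [MeasurableSpace X]
    [TopologicalSpace A] [CompactSpace A] [TopologicalSpace.MetrizableSpace A]
    [MeasurableSpace A] [BorelSpace A] {g : X × A → ℝ} (hg : Measurable g)
    (hc : ∀ x, Continuous fun a => g (x, a)) :
    StronglyMeasurable fun x => (⟨fun a => g (x, a), hc x⟩ : C(A, ℝ)) := by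
  let _ : MeasurableSpace C(A, ℝ) := borel _
  have : BorelSpace C(A, ℝ) := ⟨rfl⟩
  refine Measurable.stronglyMeasurable (measurable_of_isOpen fun U hU => ?_)
  set G : X → C(A, ℝ) := fun x => ⟨fun a => g (x, a), hc x⟩ with hG
  obtain ⟨s, hsc, hsd⟩ := TopologicalSpace.exists_countable_dense A
  obtain ⟨F, hFc, hFd⟩ := TopologicalSpace.exists_countable_dense C(A, ℝ)
  have key : ∀ (f : C(A, ℝ)) (q : ℚ), MeasurableSet {x | dist (G x) f < q} := by
    intro f q
    have : {x | dist (G x) f < q} =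
        ⋃ r ∈ {r : ℚ | 0 ≤ r ∧ r < q}, ⋂ a ∈ s, {x | dist (g (x, a)) (f a) ≤ (r : ℝ)} := by
      ext x
      simp only [Set.mem_ofPred_eq, Set.mem_iUnion, Set.mem_iInter, exists_prop]
      constructor
      · intro h
        obtain ⟨r, h1, h2⟩ := exists_rat_btwn h
        refine ⟨r, ⟨?_, by exact_mod_cast h2⟩, fun a _ => ?_⟩
        · exact_mod_cast dist_nonneg.trans h1.le
        · exact (ContinuousMap.dist_apply_le_dist (f := G x) (g := f) a).trans h1.le
      · rintro ⟨r, ⟨h0, h1⟩, h2⟩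
        refine lt_of_le_of_lt ((ContinuousMap.dist_le (by exact_mod_cast h0)).2 fun a => ?_)
          (by exact_mod_cast h1 : (r : ℝ) < q)
        have hcl : IsClosed {a | dist (G x a) (f a) ≤ (r : ℝ)} :=
          isClosed_le (by fun_prop) continuous_const
        exact (hcl.closure_subset_iff.2 fun a ha => h2 a ha) (hsd a)
    rw [this]
    refine MeasurableSet.biUnion (Set.to_countable _) fun r _ =>
      MeasurableSet.biInter hsc fun a _ => measurableSet_le ?_ measurable_const
    exact (hg.comp (measurable_id.prodMk measurable_const)).dist measurable_const
  have : G ⁻¹' U = ⋃ f ∈ F, ⋃ q ∈ {q : ℚ | Metric.ball f (q : ℝ) ⊆ U}, {x | dist (G x) f < q} := by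
    ext x
    simp only [Set.mem_preimage, Set.mem_iUnion, Set.mem_ofPred_eq, exists_prop]
    constructor
    · intro h
      obtain ⟨ε, hε, hb⟩ := Metric.isOpen_iff.1 hU _ h
      obtain ⟨q, hq0, hq⟩ := exists_rat_btwn (half_pos hε)
      obtain ⟨f, hf, hfd⟩ := hFd.exists_dist_lt (G x) hq0
      refine ⟨f, hf, q, fun y hy => hb ?_, hfd⟩
      rw [Metric.mem_ball] at hy ⊢
      have := dist_triangle y f (G x)
      rw [dist_comm f] at this
      linarith
    · rintro ⟨f, -, q, hq, hx⟩
      exact hq hx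
  rw [this]
  exact MeasurableSet.biUnion hFc fun f _ => MeasurableSet.biUnion (Set.to_countable _)
    fun q _ => key f q

/-- If the first marginals of probability measures on `X × A`, with `A` compact, converge
setwise along an ultrafilter, then the measures converge along it when tested against bounded
Carathéodory functions. -/
theorem exists_limit_of_tendsto_fst {X A ι : Type*} [MeasurableSpace X] [StandardBorelSpace X]
    [TopologicalSpace A] [CompactSpace A] [TopologicalSpace.MetrizableSpace A]
    [MeasurableSpace A] [BorelSpace A] (U : Ultrafilter ι) (γ : ι → Measure (X × A))
    [∀ i, IsProbabilityMeasure (γ i)] (m : Measure X) [IsProbabilityMeasure m]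
    (hm : ∀ f : X → ℝ, Measurable f → (∃ C, ∀ x, |f x| ≤ C) →
      Tendsto (fun i => ∫ z, f z.1 ∂(γ i)) U (𝓝 (∫ x, f x ∂m))) :
    ∃ γ' : Measure (X × A), IsProbabilityMeasure γ' ∧ γ'.fst = m ∧
      ∀ g : X × A → ℝ, Measurable g → (∃ C, ∀ z, |g z| ≤ C) →
        (∀ x, Continuous fun a => g (x, a)) →
        Tendsto (fun i => ∫ z, g z ∂(γ i)) U (𝓝 (∫ z, g z ∂γ')) := by
  obtain ⟨j, hjm, hji⟩ := MeasurableSpace.measurable_injection_nat_bool_of_countablySeparated X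
  have hj : MeasurableEmbedding j := hjm.measurableEmbedding hji
  set F : X × A → (ℕ → Bool) × A := Prod.map j id with hFdef
  have hF : MeasurableEmbedding F := hj.prodMap MeasurableEmbedding.id
  let γF : ι → ProbabilityMeasure ((ℕ → Bool) × A) := fun i =>
    ⟨(γ i).map F, Measure.isProbabilityMeasure_map hF.measurable.aemeasurable⟩
  obtain ⟨ρ, -, hρ⟩ := isCompact_univ.ultrafilter_le_nhds (U.map γF) (by simp)
  have hρ' : Tendsto γF U (𝓝 ρ) := hρ
  rw [ProbabilityMeasure.tendsto_iff_forall_integral_tendsto] at hρ'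
  have hρi : ∀ f : BoundedContinuousFunction ((ℕ → Bool) × A) ℝ,
      Tendsto (fun i => ∫ z, f (F z) ∂(γ i)) U (𝓝 (∫ z, f z ∂(ρ : Measure _))) := by
    intro f
    refine (hρ' f).congr fun i => ?_
    exact hF.integral_map _
  have hρfst : (ρ : Measure ((ℕ → Bool) × A)).fst = m.map j := by
    have : IsProbabilityMeasure (m.map j) := Measure.isProbabilityMeasure_map hjm.aemeasurable
    refine ext_of_forall_integral_eq_of_IsFiniteMeasure fun f => ?_
    rw [Measure.fst, integral_map measurable_fst.aemeasurable (by fun_prop), hj.integral_map]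
    have h1 := hρi (f.compContinuous ⟨Prod.fst, continuous_fst⟩)
    have h2 := hm (fun x => f (j x)) (f.continuous.measurable.comp hjm)
      ⟨‖f‖, fun x => f.norm_coe_le_norm _⟩
    exact tendsto_nhds_unique h1 h2
  have hrange : ∀ᵐ z ∂(ρ : Measure ((ℕ → Bool) × A)), z ∈ Set.range F := by
    have : ∀ᵐ k ∂((ρ : Measure ((ℕ → Bool) × A)).fst), k ∈ Set.range j := by
      rw [hρfst, hj.ae_map_iff]
      exact ae_of_all _ fun x => ⟨x, rfl⟩
    filter_upwards [ae_of_ae_map measurable_fst.aemeasurable this] with z hz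
    obtain ⟨x, hx⟩ := hz
    exact ⟨(x, z.2), Prod.ext hx rfl⟩
  have hmap : ((ρ : Measure ((ℕ → Bool) × A)).comap F).map F = ρ := by
    rw [hF.map_comap, Measure.restrict_eq_self_of_ae_mem hrange]
  set γ' := (ρ : Measure ((ℕ → Bool) × A)).comap F with hγ'
  have hP : IsProbabilityMeasure γ' := by
    constructor
    rw [← Set.preimage_univ (f := F), ← hF.map_apply, hmap, measure_univ]
  have hfst : γ'.fst = m := by
    have : γ'.fst.map j = m.map j := by
      rw [← hρfst, ← hmap, Measure.fst, Measure.fst, Measure.map_map hjm measurable_fst,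
        Measure.map_map measurable_fst hF.measurable]
      rfl
    rw [← hj.comap_map m, ← this, hj.comap_map]
  refine ⟨γ', hP, hfst, fun g hg ⟨C, hC⟩ hc => ?_⟩
  set G : X → C(A, ℝ) := fun x => ⟨fun a => g (x, a), hc x⟩ with hG
  have hGs : StronglyMeasurable G := stronglyMeasurable_curry_of_caratheodory hg hc
  obtain ⟨G', hG's, hG'⟩ := hj.exists_stronglyMeasurable_extend hGs (fun _ => ⟨0⟩)
  have hGb : ∀ x, ‖G x‖ ≤ |C| := fun x =>
    (ContinuousMap.norm_le _ (abs_nonneg C)).2 fun a => (hC (x, a)).trans (le_abs_self C)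
  have : IsProbabilityMeasure (m.map j) := Measure.isProbabilityMeasure_map hjm.aemeasurable
  have hmem : MemLp G' 1 (m.map j) := by
    refine MemLp.of_bound hG's.aestronglyMeasurable |C| ?_
    rw [hj.ae_map_iff]
    exact ae_of_all _ fun x => by rw [← Function.comp_apply (f := G'), hG']; exact hGb x
  rw [Metric.tendsto_nhds]
  intro ε hε
  obtain ⟨h, hh, -⟩ := hmem.exists_boundedContinuous_eLpNorm_sub_le ENNReal.one_ne_top
    (ε := ENNReal.ofReal (ε / 4)) (by positivity)
  set D : X → ℝ := fun x => ‖G x - h (j x)‖ with hD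
  have hDm : Measurable D :=
    ((hGs.sub (h.continuous.stronglyMeasurable.comp_measurable hjm)).norm).measurable
  have hDb : ∀ x, |D x| ≤ |C| + ‖h‖ := fun x => by
    rw [abs_of_nonneg (norm_nonneg _)]
    exact (norm_sub_le _ _).trans (add_le_add (hGb x) (h.norm_coe_le_norm _))
  have hDm' : ∫ x, D x ∂m ≤ ε / 4 := by
    have h1 : ∫ x, D x ∂m = ∫ k, ‖(G' - h) k‖ ∂(m.map j) := by
      rw [hj.integral_map]
      refine integral_congr_ae (ae_of_all _ fun x => ?_)
      simp only [hD, Pi.sub_apply, ← hG', Function.comp_apply]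
    rw [h1, integral_norm_eq_lintegral_enorm
      (hG's.aestronglyMeasurable.sub h.continuous.aestronglyMeasurable),
      ← eLpNorm_one_eq_lintegral_enorm]
    exact ENNReal.toReal_le_of_le_ofReal (by positivity) hh
  let H : BoundedContinuousFunction ((ℕ → Bool) × A) ℝ :=
    BoundedContinuousFunction.ofNormedAddCommGroup (fun z => h z.1 z.2) (by fun_prop) ‖h‖
      fun z => ((h z.1).norm_coe_le_norm z.2).trans (h.norm_coe_le_norm _)
  have hest : ∀ (μ : Measure (X × A)) [IsProbabilityMeasure μ],
      dist (∫ z, g z ∂μ) (∫ z, H (F z) ∂μ) ≤ ∫ z, D z.1 ∂μ := by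
    intro μ _
    have ig : Integrable g μ := Integrable.of_bound hg.aestronglyMeasurable C (ae_of_all _ hC)
    have iH : Integrable (fun z => H (F z)) μ :=
      Integrable.of_bound (H.continuous.measurable.comp hF.measurable).aestronglyMeasurable ‖H‖
        (ae_of_all _ fun z => H.norm_coe_le_norm _)
    have iD : Integrable (fun z : X × A => D z.1) μ :=
      Integrable.of_bound (hDm.comp measurable_fst).aestronglyMeasurable _
        (ae_of_all _ fun z => hDb z.1)
    rw [dist_eq_norm, ← integral_sub ig iH]
    refine (norm_integral_le_integral_norm _).trans (integral_mono (ig.sub iH).norm iD fun z => ?_)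
    exact (G z.1 - h (j z.1)).norm_coe_le_norm z.2
  have hDγ' : ∫ z, D z.1 ∂γ' ≤ ε / 4 := by
    rw [← hfst, Measure.fst, integral_map measurable_fst.aemeasurable
      hDm.aestronglyMeasurable] at hDm'
    exact hDm'
  have e1 := (hm D hDm ⟨_, hDb⟩).eventually_lt_const (show ∫ x, D x ∂m < ε / 3 by linarith)
  have e2 := Metric.tendsto_nhds.1 (hρi H) (ε / 4) (by positivity)
  filter_upwards [e1, e2] with i h1 h2
  have h3 : ∫ z, H z ∂(ρ : Measure _) = ∫ z, H (F z) ∂γ' := by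
    rw [← hmap, hF.integral_map]
  rw [h3] at h2
  have h4 := hest (γ i)
  have h5 := hest γ'
  rw [dist_comm] at h5
  have := dist_triangle4 (∫ z, g z ∂(γ i)) (∫ z, H (F z) ∂(γ i)) (∫ z, H (F z) ∂γ') (∫ z, g z ∂γ')
  linarith

theorem measurable_snoc_history (n : ℕ) :
    Measurable fun q : Hist X A n × A × X =>
      ((Fin.snoc q.1.1 (q.1.2, q.2.1), q.2.2) : Hist X A (n + 1)) := by
  refine Measurable.prodMk (measurable_pi_iff.2 fun i => ?_) (by fun_prop)
  refine Fin.lastCases ?_ (fun k => ?_) i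
  · simp only [Fin.snoc_last]
    fun_prop
  · simp only [Fin.snoc_castSucc]
    fun_prop

instance (π : Strategy X A) (n : ℕ) : IsMarkovKernel (π.1 n) := π.2 n

/-- The kernel sending `h_n` to the law of the pair `(x_n, a_{n+1})`. -/
def pairKernel (π : Strategy X A) (n : ℕ) : Kernel (Hist X A n) (X × A) :=
  Kernel.deterministic Prod.snd measurable_snd ×ₖ π.1 n

instance (π : Strategy X A) (n : ℕ) : IsMarkovKernel (pairKernel π n) := by
  unfold pairKernel; infer_instance

theorem pairLaw_eq_comp (p : Kernel (X × A) X) (π : Strategy X A) (x0 : X) (n : ℕ) :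
    pairLaw p π x0 n = pairKernel π n ∘ₘ histLaw p π x0 n := by
  unfold pairLaw
  congr 1
  funext h
  rw [pairKernel, Kernel.prod_apply, Kernel.deterministic_apply, Measure.dirac_prod]

/-- The transition kernel from histories up to stage `n` to histories up to stage `n + 1`. -/
def stepKernel (p : Kernel (X × A) X) (π : Strategy X A) (n : ℕ) :
    Kernel (Hist X A n) (Hist X A (n + 1)) :=
  (Kernel.id ×ₖ ((π.1 n) ⊗ₖ
    (p.comap (fun ha : Hist X A n × A => (ha.1.2, ha.2)) (by fun_prop)))).map
    fun q : Hist X A n × A × X => ((Fin.snoc q.1.1 (q.1.2, q.2.1), q.2.2) : Hist X A (n + 1))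

instance (p : Kernel (X × A) X) [IsMarkovKernel p] (π : Strategy X A) (n : ℕ) :
    IsMarkovKernel (stepKernel p π n) := by
  unfold stepKernel
  exact Kernel.IsMarkovKernel.map _ (measurable_snoc_history n)

theorem stepKernel_apply (p : Kernel (X × A) X) [IsMarkovKernel p] (π : Strategy X A) (n : ℕ)
    (h : Hist X A n) :
    stepKernel p π n h = ((π.1 n) h).bind fun a =>
      (p (h.2, a)).map fun x' => ((Fin.snoc h.1 (h.2, a), x') : Hist X A (n + 1)) := by
  ext s hs
  have hΦ := measurable_snoc_history (X := X) (A := A) n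
  have hΦ' : Measurable fun q : A × X =>
      ((Fin.snoc h.1 (h.2, q.1), q.2) : Hist X A (n + 1)) :=
    hΦ.comp (measurable_const.prodMk measurable_id)
  have happ : ∀ a : A, ∀ t : Set (Hist X A (n + 1)), MeasurableSet t →
      (p (h.2, a)).map (fun x' => ((Fin.snoc h.1 (h.2, a), x') : Hist X A (n + 1))) t =
        p (h.2, a) {x' | ((Fin.snoc h.1 (h.2, a), x') : Hist X A (n + 1)) ∈ t} := fun a t ht =>
    Measure.map_apply (hΦ'.comp (measurable_const.prodMk measurable_id)) ht
  have hmeas : Measurable fun a : A =>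
      (p (h.2, a)).map fun x' => ((Fin.snoc h.1 (h.2, a), x') : Hist X A (n + 1)) := by
    refine Measure.measurable_of_measurable_coe _ fun t ht => ?_
    simp_rw [happ _ t ht]
    exact Kernel.measurable_kernel_prodMk_left (κ := p.comap (fun a : A => (h.2, a)) (by fun_prop))
      (hΦ' ht)
  rw [Measure.bind_apply hs hmeas.aemeasurable, stepKernel, Kernel.map_apply' _ hΦ _ hs,
    Kernel.prod_apply, Kernel.id_apply, Measure.dirac_prod,
    Measure.map_apply (by fun_prop) (hΦ hs), Kernel.compProd_apply (measurable_prodMk_left (hΦ hs))]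
  simp_rw [happ _ s hs]
  rfl

theorem histLaw_succ (p : Kernel (X × A) X) [IsMarkovKernel p] (π : Strategy X A) (x0 : X)
    (n : ℕ) : histLaw p π x0 (n + 1) = stepKernel p π n ∘ₘ histLaw p π x0 n := by
  rw [histLaw]
  congr 1
  funext h
  rw [stepKernel_apply]

instance (p : Kernel (X × A) X) [IsMarkovKernel p] (π : Strategy X A) (x0 : X) (n : ℕ) :
    IsProbabilityMeasure (histLaw p π x0 n) := by
  induction n with
  | zero => rw [histLaw]; infer_instance
  | succ n ih => rw [histLaw_succ]; infer_instance

instance (p : Kernel (X × A) X) [IsMarkovKernel p] (π : Strategy X A) (x0 : X) (n : ℕ) :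
    IsProbabilityMeasure (pairLaw p π x0 n) := by
  rw [pairLaw_eq_comp]; infer_instance

theorem fst_pairLaw (p : Kernel (X × A) X) [IsMarkovKernel p] (π : Strategy X A) (x0 : X) (n : ℕ) :
    (pairLaw p π x0 n).fst = (histLaw p π x0 n).map Prod.snd := by
  rw [pairLaw_eq_comp, pairKernel, Measure.fst, Measure.map_comp _ _ measurable_fst,
    ← Kernel.fst_eq, Kernel.fst_prod, Measure.deterministic_comp_eq_map]

theorem map_snd_histLaw_succ (p : Kernel (X × A) X) [IsMarkovKernel p] (π : Strategy X A) (x0 : X)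
    (n : ℕ) : (histLaw p π x0 (n + 1)).map Prod.snd = p ∘ₘ pairLaw p π x0 n := by
  rw [histLaw_succ, pairLaw_eq_comp, Measure.map_comp _ _ measurable_snd, Measure.comp_assoc]
  congr 1
  ext h s hs
  have hΦ := measurable_snoc_history (X := X) (A := A) n
  rw [Kernel.map_apply' _ measurable_snd _ hs, stepKernel,
    Kernel.map_apply' _ hΦ _ (measurable_snd hs), Kernel.prod_apply, Kernel.id_apply,
    Measure.dirac_prod, Measure.map_apply (by fun_prop) (hΦ (measurable_snd hs)),
    Kernel.compProd_apply (measurable_prodMk_left (hΦ (measurable_snd hs))),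
    Kernel.comp_apply' _ _ _ hs, pairKernel, Kernel.prod_apply, Kernel.deterministic_apply,
    Measure.dirac_prod, lintegral_map (p.measurable_coe hs) (by fun_prop)]
  rfl

theorem fst_pairLaw_zero (p : Kernel (X × A) X) [IsMarkovKernel p] (π : Strategy X A) (x0 : X) :
    (pairLaw p π x0 0).fst = Measure.dirac x0 := by
  rw [fst_pairLaw]
  exact Measure.map_dirac' measurable_snd _

theorem fst_pairLaw_succ (p : Kernel (X × A) X) [IsMarkovKernel p] (π : Strategy X A) (x0 : X)
    (n : ℕ) : (pairLaw p π x0 (n + 1)).fst = p ∘ₘ pairLaw p π x0 n := by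
  rw [fst_pairLaw, map_snd_histLaw_succ]

theorem histLaw_congr (p : Kernel (X × A) X) [IsMarkovKernel p] {π π' : Strategy X A} (x0 : X)
    {n : ℕ} (h : ∀ k < n, π.1 k = π'.1 k) : histLaw p π x0 n = histLaw p π' x0 n := by
  induction n with
  | zero => rfl
  | succ n ih =>
    rw [histLaw_succ, histLaw_succ, ih fun k hk => h k (hk.trans n.lt_succ_self)]
    simp only [stepKernel, h n n.lt_succ_self]

/-- A strategy that uses only the current state at stage `n` gives a joint law of
`(X_n, A_{n+1})` that disintegrates through it. -/
theorem pairLaw_eq_compProd (p : Kernel (X × A) X) [IsMarkovKernel p] (π : Strategy X A) (x0 : X)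
    {n : ℕ} (φ : Kernel X A) [IsMarkovKernel φ] (h : π.1 n = φ.comap Prod.snd measurable_snd) :
    pairLaw p π x0 n = (pairLaw p π x0 n).fst ⊗ₘ φ := by
  rw [fst_pairLaw, pairLaw_eq_comp]
  ext s hs
  rw [Measure.bind_apply hs (Kernel.aemeasurable _), Measure.compProd_apply hs,
    lintegral_map (Kernel.measurable_kernel_prodMk_left hs) measurable_snd]
  refine lintegral_congr fun q => ?_
  rw [pairKernel, Kernel.prod_apply, Kernel.deterministic_apply, Measure.dirac_prod,
    Measure.map_apply (by fun_prop) hs, h, Kernel.comap_apply]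

theorem survive_eq_fst (p : Kernel ((Y ⊕ Unit) × A) (Y ⊕ Unit)) (π : Strategy (Y ⊕ Unit) A)
    (x0 : Y ⊕ Unit) (t : ℕ) :
    survive p π x0 t = (pairLaw p π x0 t).fst (Set.range Sum.inl) := by
  rw [Measure.fst_apply measurableSet_range_inl, survive]
  congr 1
  ext z
  simp [eq_comm]

/-- The strategy that follows `π` before stage `N` and the stationary kernel `φ` from then on. -/
def Strategy.switch (π : Strategy X A) (N : ℕ) (φ : Kernel X A) [hφ : IsMarkovKernel φ] :
    Strategy X A :=
  ⟨fun n => if n < N then π.1 n else φ.comap Prod.snd measurable_snd, fun n => by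
    by_cases h : n < N
    · simpa only [h, if_true] using π.2 n
    · simp only [h, if_false]
      infer_instance⟩

/-- In an absorbing model, an invariant finite measure carried by the non-absorbed states and
dominated by the state-action frequencies of some strategy is zero. -/
theorem eq_zero_of_invariant_of_isAbsorbing [StandardBorelSpace A] [Nonempty A]
    {p : Kernel ((Y ⊕ Unit) × A) (Y ⊕ Unit)} [IsMarkovKernel p] {x0 : Y ⊕ Unit}
    (habs : IsAbsorbing p x0) (π : Strategy (Y ⊕ Unit) A) (ν : Measure ((Y ⊕ Unit) × A))
    [IsFiniteMeasure ν] (hle : ν ≤ Measure.sum (pairLaw p π x0)) (hinv : p ∘ₘ ν = ν.fst)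
    (hsupp : ν.fst (Set.range Sum.inl)ᶜ = 0) : ν = 0 := by
  set φ := ν.condKernel with hφ
  set Q : Kernel (Y ⊕ Unit) (Y ⊕ Unit) := p ∘ₖ (Kernel.id ×ₖ φ) with hQ
  have hQc : ∀ μ : Measure (Y ⊕ Unit), SFinite μ → Q ∘ₘ μ = p ∘ₘ (μ ⊗ₘ φ) := fun μ _ => by
    rw [Measure.compProd_eq_comp_prod, Measure.comp_assoc]
  have hQinv : Q ∘ₘ ν.fst = ν.fst := by
    rw [hQc _ inferInstance, ν.disintegrate φ, hinv]
  have hsing : ∀ N, (pairLaw p π x0 N).fst ⟂ₘ ν.fst := by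
    intro N
    rw [← Measure.rnDeriv_eq_zero]
    set ρ := ν.fst.withDensity ((pairLaw p π x0 N).fst.rnDeriv ν.fst) with hρ
    suffices hρ0 : ρ Set.univ = 0 by
      rwa [Measure.measure_univ_eq_zero, hρ,
        withDensity_eq_zero_iff (Measure.measurable_rnDeriv _ _).aemeasurable] at hρ0
    by_contra hρ0
    have hfst : (pairLaw p (π.switch N φ) x0 N).fst = (pairLaw p π x0 N).fst := by
      rw [fst_pairLaw, fst_pairLaw, histLaw_congr p x0 fun k hk => ?_]
      simp [Strategy.switch, hk]
    have hiter : ∀ t, ∃ ρ' : Measure (Y ⊕ Unit), ρ' ≤ (pairLaw p (π.switch N φ) x0 (N + t)).fst ∧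
        ρ' ≪ ν.fst ∧ ρ' Set.univ = ρ Set.univ := by
      intro t
      induction t with
      | zero =>
        refine ⟨ρ, ?_, withDensity_absolutelyContinuous _ _, rfl⟩
        rw [add_zero, hfst]
        exact Measure.withDensity_rnDeriv_le _ _
      | succ t ih =>
        obtain ⟨ρ', h1, h2, h3⟩ := ih
        refine ⟨Q ∘ₘ ρ', ?_, ?_, ?_⟩
        · rw [← add_assoc, fst_pairLaw_succ, pairLaw_eq_compProd p _ x0 φ (n := N + t)
            (by simp [Strategy.switch]), ← hQc _ inferInstance]
          refine Measure.le_iff.2 fun s hs => ?_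
          rw [Measure.bind_apply hs Q.aemeasurable, Measure.bind_apply hs Q.aemeasurable]
          exact lintegral_mono' h1 le_rfl
        · rw [← hQinv]
          exact h2.comp_right Q
        · rw [Measure.bind_apply MeasurableSet.univ Q.aemeasurable]
          simpa using h3
    have hlow : ∀ t, ρ Set.univ ≤ survive p (π.switch N φ) x0 (N + t) := by
      intro t
      obtain ⟨ρ', h1, h2, h3⟩ := hiter t
      rw [survive_eq_fst, ← h3, ← measure_add_measure_compl (s := Set.range Sum.inl)
        measurableSet_range_inl, h2 hsupp, add_zero]
      exact h1 _
    refine (habs (π.switch N φ)).ne (top_unique ?_)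
    calc ⊤ = ∑' _ : ℕ, ρ Set.univ := (ENNReal.tsum_const_eq_top_of_ne_zero hρ0).symm
      _ ≤ ∑' t, survive p (π.switch N φ) x0 (N + t) := ENNReal.tsum_le_tsum hlow
      _ ≤ _ := ENNReal.tsum_comp_le_tsum_of_injective (add_right_injective N) _
  have hself : ν.fst ⟂ₘ ν.fst := by
    refine (Measure.MutuallySingular.sum_left.2 hsing).mono (Measure.le_iff.2 fun s hs => ?_) le_rfl
    rw [Measure.sum_apply _ hs, Measure.fst_apply hs]
    refine (hle _).trans ?_
    rw [Measure.sum_apply _ (measurable_fst hs)]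
    simp_rw [Measure.fst_apply hs]
    exact le_rfl
  have h0 : ν.fst = 0 := (Measure.MutuallySingular.self_iff _).1 hself
  rw [← Measure.measure_univ_eq_zero, ← Measure.fst_univ, h0]
  rfl

/-- Under Condition (S), the laws of the pairs `(X_n, A_{n+1})` converge along any ultrafilter,
when tested against bounded Carathéodory functions, to laws that obey the same dynamics. -/
theorem exists_pairLaw_limit {ι : Type*} [StandardBorelSpace X] [TopologicalSpace A]
    [BorelSpace A] [TopologicalSpace.MetrizableSpace A]
    (p : Kernel (X × A) X) [IsMarkovKernel p] (hS : ConditionS p) (U : Ultrafilter ι)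
    (π : ι → Strategy X A) (x0 : X) :
    ∃ q : ℕ → Measure (X × A), (∀ n, IsProbabilityMeasure (q n)) ∧
      (q 0).fst = Measure.dirac x0 ∧ (∀ n, (q (n + 1)).fst = p ∘ₘ q n) ∧
      ∀ n, ∀ g : X × A → ℝ, Measurable g → (∃ C, ∀ z, |g z| ≤ C) →
        (∀ x, Continuous fun a => g (x, a)) →
        Tendsto (fun i => ∫ z, g z ∂(pairLaw p (π i) x0 n)) U (𝓝 (∫ z, g z ∂(q n))) := by
  obtain ⟨hA, hS⟩ := hS
  let P : ℕ → Measure (X × A) → Prop := fun n q => IsProbabilityMeasure q ∧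
    ∀ g : X × A → ℝ, Measurable g → (∃ C, ∀ z, |g z| ≤ C) →
        (∀ x, Continuous fun a => g (x, a)) →
        Tendsto (fun i => ∫ z, g z ∂(pairLaw p (π i) x0 n)) U (𝓝 (∫ z, g z ∂q))
  have hfst : ∀ (μ : Measure (X × A)) (f : X → ℝ), Measurable f →
      ∫ z, f z.1 ∂μ = ∫ x, f x ∂μ.fst := fun μ f hf => by
    rw [Measure.fst, integral_map measurable_fst.aemeasurable hf.aestronglyMeasurable]
  have hbase : ∃ q, P 0 q ∧ q.fst = Measure.dirac x0 := by
    obtain ⟨q, h1, h2, h3⟩ := exists_limit_of_tendsto_fst U (fun i => pairLaw p (π i) x0 0)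
      (Measure.dirac x0) fun f hf _ => by
        simp_rw [hfst _ f hf, fst_pairLaw_zero]
        exact tendsto_const_nhds
    exact ⟨q, ⟨h1, h3⟩, h2⟩
  have hstep : ∀ n q, P n q → ∃ q', P (n + 1) q' ∧ q'.fst = p ∘ₘ q := by
    rintro n q ⟨hq, hlim⟩
    obtain ⟨q', h1, h2, h3⟩ := exists_limit_of_tendsto_fst U
      (fun i => pairLaw p (π i) x0 (n + 1)) (p ∘ₘ q) fun f hf ⟨C, hC⟩ => by
        have hint : ∀ μ : Measure (X × A), IsProbabilityMeasure μ →
            ∫ x, f x ∂(p ∘ₘ μ) = ∫ z, ∫ x, f x ∂(p z) ∂μ := fun μ _ => by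
          rw [Measure.comp_eq_comp_const_apply, Kernel.integral_comp, Kernel.const_apply]
          exact Integrable.of_bound hf.aestronglyMeasurable C (ae_of_all _ hC)
        simp_rw [hfst _ f hf, fst_pairLaw_succ, hint _ inferInstance]
        refine hlim _ (hf.stronglyMeasurable.integral_kernel).measurable ⟨C, fun z => ?_⟩
          fun x => hS f hf ⟨C, hC⟩ x
        have := norm_integral_le_of_norm_le_const (μ := p z) (f := f) (C := C) (ae_of_all _ hC)
        simpa using this
    exact ⟨q', ⟨h1, h3⟩, h2⟩
  obtain ⟨q0, hP0, hq0⟩ := hbase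
  choose! next hnext using hstep
  let q : ℕ → Measure (X × A) := fun n => Nat.rec q0 next n
  have hq : ∀ n, P n (q n) := fun n => by
    induction n with
    | zero => exact hP0
    | succ n ih => exact (hnext n _ ih).1
  exact ⟨q, fun n => (hq n).1, hq0, fun n => (hnext n _ (hq n)).2, fun n => (hq n).2⟩

instance {α β : Type*} [MeasurableSpace α] [MeasurableSpace β] [StandardBorelSpace α]
    [StandardBorelSpace β] : StandardBorelSpace (α ⊕ β) := by
  let _ := upgradeStandardBorel α
  let _ := upgradeStandardBorel β
  have hb : BorelSpace (α ⊕ β) := by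
    refine ⟨le_antisymm (fun s hs => ?_) (MeasurableSpace.generateFrom_le fun s hs => ?_)⟩
    · let _ : MeasurableSpace (α ⊕ β) := borel _
      have : BorelSpace (α ⊕ β) := ⟨rfl⟩
      rw [← Set.image_preimage_inl_union_image_preimage_inr s]
      have hs := measurableSet_sum_iff.1 hs
      exact (Topology.IsOpenEmbedding.inl.measurableEmbedding.measurableSet_image.2 hs.1).union
        (Topology.IsOpenEmbedding.inr.measurableEmbedding.measurableSet_image.2 hs.2)
    · exact measurableSet_sum_iff.2
        ⟨(isOpen_sum_iff.1 hs).1.measurableSet, (isOpen_sum_iff.1 hs).2.measurableSet⟩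
  have : PolishSpace (α ⊕ β) := {}
  infer_instance

/-- A measure is dominated by a finite measure as soon as its integrals of nonnegative bounded
continuous functions are. -/
theorem measure_le_of_forall_lintegral_le {Ω : Type*} [TopologicalSpace Ω]
    [TopologicalSpace.PseudoMetrizableSpace Ω] [MeasurableSpace Ω] [BorelSpace Ω]
    {μ ν : Measure Ω} [IsFiniteMeasure ν]
    (h : ∀ f : Ω →ᵇ ℝ≥0, ∫⁻ x, f x ∂μ ≤ ∫⁻ x, f x ∂ν) : μ ≤ ν := by
  let _ := TopologicalSpace.pseudoMetrizableSpacePseudoMetric Ω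
  have hμ : IsFiniteMeasure μ := by
    refine ⟨lt_of_le_of_lt ?_ (measure_lt_top ν Set.univ)⟩
    simpa using h 1
  refine Measure.le_iff.2 fun s hs => ?_
  rw [hs.measure_eq_iSup_isClosed_of_ne_top (measure_ne_top μ s)]
  refine iSup₂_le fun F hFs => iSup_le fun hF => ?_
  refine le_trans ?_ (measure_mono hFs)
  exact ge_of_tendsto' (HasOuterApproxClosed.tendsto_lintegral_apprSeq hF ν) fun n =>
    (HasOuterApproxClosed.measure_le_lintegral hF μ n).trans (h _)

/-- The state-action pairs whose state is not the cemetery. -/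
abbrev alive (Y A : Type*) : Set ((Y ⊕ Unit) × A) := Prod.fst ⁻¹' Set.range Sum.inl

theorem measurableSet_alive : MeasurableSet (alive Y A) := measurable_fst measurableSet_range_inl

theorem survive_eq (p : Kernel ((Y ⊕ Unit) × A) (Y ⊕ Unit)) (π : Strategy (Y ⊕ Unit) A)
    (x0 : Y ⊕ Unit) (t : ℕ) : survive p π x0 t = pairLaw p π x0 t (alive Y A) := by
  rw [survive_eq_fst, Measure.fst_apply measurableSet_range_inl]

/-- Balance equation for the state-action frequencies of non-absorbed states. -/
theorem fst_sum_restrict_alive {p : Kernel ((Y ⊕ Unit) × A) (Y ⊕ Unit)} [IsMarkovKernel p]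
    (hcem : ∀ a : A, p (Sum.inr (), a) {(Sum.inr () : Y ⊕ Unit)} = 1) {x0 : Y ⊕ Unit}
    {c : ℕ → Measure ((Y ⊕ Unit) × A)} (h0 : (c 0).fst = Measure.dirac x0)
    (hc : ∀ n, (c (n + 1)).fst = p ∘ₘ c n) :
    ((Measure.sum c).restrict (alive Y A)).fst = (Measure.dirac x0).restrict (Set.range Sum.inl) +
      (p ∘ₘ (Measure.sum c).restrict (alive Y A)).restrict (Set.range Sum.inl) := by
  ext B hB
  have hBS : MeasurableSet (B ∩ Set.range Sum.inl : Set (Y ⊕ Unit)) :=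
    hB.inter measurableSet_range_inl
  have hΔ : MeasurableSet {(Sum.inr () : Y ⊕ Unit)} := by
    simpa using (measurableSet_inr_image (α := Y)).2 (MeasurableSet.singleton ())
  have hzero : ∀ z ∉ alive Y A, p z (B ∩ Set.range Sum.inl) = 0 := by
    rintro ⟨y | u, a⟩ hz
    · simp at hz
    · refine measure_mono_null (Set.inter_subset_right.trans ?_)
        ((prob_compl_eq_zero_iff hΔ).2 (hcem a))
      rintro _ ⟨y, rfl⟩
      simp
  have hind : (alive Y A).indicator (fun z => p z (B ∩ Set.range Sum.inl)) =
      fun z => p z (B ∩ Set.range Sum.inl) :=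
    Set.indicator_eq_self.2 fun z hz => by_contra fun h => hz (hzero z h)
  rw [Measure.fst_apply hB, Measure.restrict_apply (measurable_fst hB), ← Set.preimage_inter,
    Measure.sum_apply _ (measurable_fst hBS), tsum_eq_zero_add' ENNReal.summable, Measure.add_apply,
    Measure.restrict_apply hB, Measure.restrict_apply hB, ← Measure.fst_apply hBS, h0,
    Measure.bind_apply hBS p.aemeasurable, ← lintegral_indicator measurableSet_alive, hind,
    lintegral_sum_measure]
  congr 1
  refine tsum_congr fun n => ?_
  rw [← Measure.fst_apply hBS, hc, Measure.bind_apply hBS p.aemeasurable]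

/-- In an absorbing model, the frequencies of non-absorbed states generated by a strategy are
minimal among those of all solutions of the same dynamics. -/
theorem sum_restrict_alive_eq_of_le [StandardBorelSpace A] [Nonempty A]
    {p : Kernel ((Y ⊕ Unit) × A) (Y ⊕ Unit)} [IsMarkovKernel p]
    (hcem : ∀ a : A, p (Sum.inr (), a) {(Sum.inr () : Y ⊕ Unit)} = 1) {x0 : Y ⊕ Unit}
    (habs : IsAbsorbing p x0) (π : Strategy (Y ⊕ Unit) A)
    {c : ℕ → Measure ((Y ⊕ Unit) × A)} (h0 : (c 0).fst = Measure.dirac x0)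
    (hc : ∀ n, (c (n + 1)).fst = p ∘ₘ c n)
    (hle : (Measure.sum c).restrict (alive Y A) ≤
      (Measure.sum (pairLaw p π x0)).restrict (alive Y A)) :
    (Measure.sum c).restrict (alive Y A) =
      (Measure.sum (pairLaw p π x0)).restrict (alive Y A) := by
  have hbal' := fst_sum_restrict_alive hcem h0 hc
  have hbal := fst_sum_restrict_alive hcem (fst_pairLaw_zero p π x0) (fst_pairLaw_succ p π x0)
  have hfin : IsFiniteMeasure ((Measure.sum (pairLaw p π x0)).restrict (alive Y A)) := by
    refine ⟨?_⟩
    rw [Measure.restrict_apply_univ, Measure.sum_apply _ measurableSet_alive]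
    simpa only [survive_eq] using habs π
  have hsub : (Measure.sum (pairLaw p π x0)).restrict (alive Y A) ≤
    Measure.sum (pairLaw p π x0) := Measure.restrict_le_self
  generalize (Measure.sum c).restrict (alive Y A) = M' at *
  generalize (Measure.sum (pairLaw p π x0)).restrict (alive Y A) = M at *
  have hfin' : IsFiniteMeasure M' := isFiniteMeasure_of_le M hle
  have hadd : M - M' + M' = M := Measure.sub_add_cancel_of_le hle
  have hνM : M - M' ≤ M := Measure.sub_le
  have hfinν : IsFiniteMeasure (M - M') := isFiniteMeasure_of_le M hνM
  generalize M - M' = ν at *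
  subst hadd
  have hfst : ν.fst = (p ∘ₘ ν).restrict (Set.range Sum.inl) := by
    refine Measure.ext fun B hB => ?_
    have h1 := congrArg (· B) hbal
    have h2 := congrArg (· B) hbal'
    simp only [Measure.fst, Measure.map_add _ _ measurable_fst, Measure.comp_add,
      Measure.restrict_add, Measure.add_apply] at h1 h2
    have hne : M'.map Prod.fst B ≠ ⊤ := measure_ne_top M'.fst B
    rw [add_left_comm, ← h2, add_comm] at h1
    exact (ENNReal.add_left_inj hne).1 ((add_comm _ _).trans h1)
  have hν : ν = 0 := by
    refine eq_zero_of_invariant_of_isAbsorbing habs π ν (hνM.trans hsub) ?_ ?_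
    · have huniv : (p ∘ₘ ν) (Set.range Sum.inl) = (p ∘ₘ ν) Set.univ := by
        rw [← Measure.restrict_apply_univ, ← hfst, Measure.fst_univ,
          Measure.bind_apply MeasurableSet.univ p.aemeasurable]
        simp
      rw [hfst, Measure.restrict_eq_self_of_ae_mem]
      exact (ae_mem_iff_measure_eq measurableSet_range_inl.nullMeasurableSet).2 huniv
    · rw [hfst, Measure.restrict_apply measurableSet_range_inl.compl]
      simp
  rw [hν, zero_add]

theorem measurableEmbedding_inl_prodMk :
    MeasurableEmbedding fun ya : Y × A => ((Sum.inl ya.1, ya.2) : (Y ⊕ Unit) × A) :=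
  MeasurableEmbedding.prodMap ⟨Sum.inl_injective, measurable_inl, fun _ => MeasurableSet.inl_image⟩
    MeasurableEmbedding.id

theorem range_inl_prodMk {Y A : Type*} :
    Set.range (fun ya : Y × A => ((Sum.inl ya.1, ya.2) : (Y ⊕ Unit) × A)) = alive Y A := by
  ext ⟨y | u, a⟩ <;> simp

theorem map_sum_comap_inl (c : ℕ → Measure ((Y ⊕ Unit) × A)) :
    (Measure.sum fun n => (c n).comap fun ya : Y × A => (Sum.inl ya.1, ya.2)).map
      (fun ya => (Sum.inl ya.1, ya.2)) = (Measure.sum c).restrict (alive Y A) := by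
  rw [Measure.map_sum measurableEmbedding_inl_prodMk.measurable.aemeasurable,
    Measure.restrict_sum _ measurableSet_alive]
  congr 1
  funext n
  rw [measurableEmbedding_inl_prodMk.map_comap, range_inl_prodMk]

theorem occupation_univ (p : Kernel ((Y ⊕ Unit) × A) (Y ⊕ Unit)) (π : Strategy (Y ⊕ Unit) A)
    (x0 : Y ⊕ Unit) : occupation p π x0 Set.univ = ∑' t, survive p π x0 t := by
  rw [occupation, Measure.sum_apply _ MeasurableSet.univ]
  refine tsum_congr fun t => ?_
  rw [measurableEmbedding_inl_prodMk.comap_apply, Set.image_univ, range_inl_prodMk, survive_eq]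

theorem BoundedContinuousFunction.abs_coe_le_nndist {Ω : Type*} [TopologicalSpace Ω]
    (f : Ω →ᵇ ℝ≥0) (x : Ω) : |(f x : ℝ)| ≤ nndist f 0 := by
  simpa only [BoundedContinuousFunction.coe_zero, Pi.zero_apply, NNReal.nndist_zero_eq_val',
    NNReal.abs_eq, NNReal.coe_le_coe] using f.nndist_coe_le_nndist (g := 0) x

/-- Convergence of Bochner integrals of a nonnegative bounded continuous function gives convergence
of its Lebesgue integrals. -/
theorem tendsto_lintegral_of_tendsto_integral {ι Ω : Type*} [TopologicalSpace Ω]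
    [MeasurableSpace Ω] [OpensMeasurableSpace Ω] {l : Filter ι} {μ : ι → Measure Ω}
    {ν : Measure Ω} [∀ i, IsFiniteMeasure (μ i)] [IsFiniteMeasure ν] {f : Ω →ᵇ ℝ≥0}
    (h : Tendsto (fun i => ∫ x, (f x : ℝ) ∂(μ i)) l (𝓝 (∫ x, (f x : ℝ) ∂ν))) :
    Tendsto (fun i => ∫⁻ x, f x ∂(μ i)) l (𝓝 (∫⁻ x, f x ∂ν)) := by
  rw [← ENNReal.tendsto_toReal_iff (fun i => (f.lintegral_lt_top_of_nnreal _).ne)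
    (f.lintegral_lt_top_of_nnreal _).ne]
  simpa only [BoundedContinuousFunction.toReal_lintegral_coe_eq_integral] using h

/-- Convergence against bounded Carathéodory functions on `(Y ∪ {Δ}) × A` passes to
the restrictions to `Y × A`. -/
theorem tendsto_lintegral_comap_inl {ι : Type*} [TopologicalSpace Y] [BorelSpace Y]
    [TopologicalSpace A] [BorelSpace A] [SecondCountableTopologyEither Y A] {l : Filter ι}
    {μ : ι → Measure ((Y ⊕ Unit) × A)} {ν : Measure ((Y ⊕ Unit) × A)}
    [∀ i, IsFiniteMeasure (μ i)] [IsFiniteMeasure ν]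
    (h : ∀ g : (Y ⊕ Unit) × A → ℝ, Measurable g → (∃ C, ∀ z, |g z| ≤ C) →
        (∀ x, Continuous fun a => g (x, a)) →
        Tendsto (fun i => ∫ z, g z ∂(μ i)) l (𝓝 (∫ z, g z ∂ν))) (f : Y × A →ᵇ ℝ≥0) :
    Tendsto (fun i => ∫⁻ x, f x ∂((μ i).comap fun ya : Y × A => (Sum.inl ya.1, ya.2))) l
      (𝓝 (∫⁻ x, f x ∂(ν.comap fun ya : Y × A => (Sum.inl ya.1, ya.2)))) := by
  set e : Y × A → (Y ⊕ Unit) × A := fun ya => (Sum.inl ya.1, ya.2) with he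
  have hF : MeasurableEmbedding e := measurableEmbedding_inl_prodMk
  have hfin : ∀ μ : Measure ((Y ⊕ Unit) × A), IsFiniteMeasure μ →
      IsFiniteMeasure (μ.comap e) := fun μ _ =>
    ⟨by rw [hF.comap_apply]; exact measure_lt_top _ _⟩
  have := fun i => hfin (μ i) inferInstance
  have := hfin ν inferInstance
  set g : (Y ⊕ Unit) × A → ℝ := Function.extend e (fun z => (f z : ℝ)) 0 with hg
  have hge : ∀ z, g (e z) = f z := fun z => hF.injective.extend_apply _ _ z
  have hgr : ∀ u a, g (Sum.inr u, a) = 0 := fun u a => by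
    rw [hg, Function.extend_apply' _ _ _ (by simp [he])]
    rfl
  have hfm : Measurable fun z => (f z : ℝ) := f.continuous.measurable.coe_nnreal_real
  have hint : ∀ μ : Measure ((Y ⊕ Unit) × A), ∫ z, (f z : ℝ) ∂(μ.comap e) = ∫ z, g z ∂μ := by
    intro μ
    simp_rw [← hge]
    rw [← hF.integral_map, hF.map_comap, setIntegral_eq_integral_of_forall_compl_eq_zero]
    rintro ⟨y | u, a⟩ hz
    · exact absurd ⟨(y, a), rfl⟩ hz
    · exact hgr u a
  refine tendsto_lintegral_of_tendsto_integral ?_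
  simp_rw [hint]
  refine h g (hF.measurable_extend hfm measurable_zero) ⟨nndist f 0, ?_⟩ ?_
  · rintro ⟨y | u, a⟩
    · rw [show ((Sum.inl y, a) : (Y ⊕ Unit) × A) = e (y, a) from rfl, hge]
      exact f.abs_coe_le_nndist (y, a)
    · rw [hgr]
      simp
  · rintro (y | u)
    · simp_rw [show ∀ a, ((Sum.inl y, a) : (Y ⊕ Unit) × A) = e (y, a) from fun _ => rfl, hge]
      fun_prop
    · simp_rw [hgr]
      fun_prop

theorem continuous_wTop_integral {Ω : Type*} [TopologicalSpace Ω] [MeasurableSpace Ω]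
    {g : Ω → ℝ} (hg : Continuous g) (hb : ∃ C, ∀ z, |g z| ≤ C) :
    @Continuous _ _ (wTop Ω) _ fun η : FiniteMeasure Ω => ∫ z, g z ∂(η : Measure Ω) := by
  unfold wTop
  refine continuous_iInf_dom (i := g) ?_
  refine continuous_iInf_dom (i := hg) ?_
  refine continuous_iInf_dom (i := hb) ?_
  exact continuous_induced_dom

/-- If the occupation measures over `Λ` form a w-compact set, then along any ultrafilter they
converge weakly to an occupation measure over `Λ`. -/
theorem exists_tendsto_lintegral_occupation {ι : Type*} [TopologicalSpace Y] [BorelSpace Y]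
    [TopologicalSpace A] [BorelSpace A] [SecondCountableTopologyEither Y A]
    {p : Kernel ((Y ⊕ Unit) × A) (Y ⊕ Unit)} [IsMarkovKernel p] {x0 : Y ⊕ Unit}
    (habs : IsAbsorbing p x0) {Λ : Set (Strategy (Y ⊕ Unit) A)}
    (hcomp : @IsCompact _ (wTop (Y × A)) (OccSet p Λ x0)) (U : Ultrafilter ι)
    {π : ι → Strategy (Y ⊕ Unit) A} (hπ : ∀ i, π i ∈ Λ) :
    ∃ π' ∈ Λ, ∀ f : Y × A →ᵇ ℝ≥0, Tendsto (fun i => ∫⁻ x, f x ∂(occupation p (π i) x0)) U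
      (𝓝 (∫⁻ x, f x ∂(occupation p π' x0))) := by
  have hfin : ∀ π, IsFiniteMeasure (occupation p π x0) := fun π =>
    ⟨by rw [occupation_univ]; exact habs π⟩
  let _ := wTop (Y × A)
  let η : ι → FiniteMeasure (Y × A) := fun i => ⟨occupation p (π i) x0, hfin _⟩
  obtain ⟨η', ⟨π', hπ', hη'⟩, hU⟩ := hcomp.ultrafilter_le_nhds (U.map η)
    (le_principal_iff.2 (Filter.mem_map.2 (Filter.Eventually.of_forall fun i => ⟨π i, hπ i, rfl⟩)))
  refine ⟨π', hπ', fun f => tendsto_lintegral_of_tendsto_integral ?_⟩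
  rw [← hη']
  have hf : Continuous fun x => (f x : ℝ) := by fun_prop
  exact ((continuous_wTop_integral hf ⟨nndist f 0, fun x =>
    f.abs_coe_le_nndist x⟩).tendsto η').comp hU

/-- Lemma 1 of the paper.  Under Condition (S), if the MDP model
`{Y ∪ {Δ}, A, p}` is absorbing with initial state `x0` and the set `D^Λ_{x0}` of occupation
measures over a nonempty set of strategies `Λ` is w-compact in `M(Y × A)`, then the model is
`Λ`-uniformly absorbing with initial state `x0`. -/
theorem stmt0
    {Y A : Type*}
    [TopologicalSpace Y] [MeasurableSpace Y] [BorelSpace Y]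
    [TopologicalSpace.MetrizableSpace Y] [SecondCountableTopology Y] [StandardBorelSpace Y]
    [Nonempty Y]
    [TopologicalSpace A] [MeasurableSpace A] [BorelSpace A]
    [TopologicalSpace.MetrizableSpace A] [SecondCountableTopology A] [StandardBorelSpace A]
    [Nonempty A]
    (p : Kernel ((Y ⊕ Unit) × A) (Y ⊕ Unit)) [IsMarkovKernel p]
    (hcem : ∀ a : A, p (Sum.inr (), a) {(Sum.inr () : Y ⊕ Unit)} = 1)
    (x0 : Y ⊕ Unit)
    (habs : IsAbsorbing p x0)
    (hS : ConditionS p)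
    (Λ : Set (Strategy (Y ⊕ Unit) A)) (hΛ : Λ.Nonempty)
    (hcomp : @IsCompact _ (wTop (Y × A)) (OccSet p Λ x0)) :
    IsUnifAbsorbing p Λ x0 := by
  have htail : ∀ (π : Strategy (Y ⊕ Unit) A) {m n : ℕ}, m ≤ n →
      ∑' t, survive p π x0 (n + t) ≤ ∑' t, survive p π x0 (m + t) := by
    intro π m n hmn
    obtain ⟨d, rfl⟩ := Nat.exists_eq_add_of_le hmn
    simp_rw [add_assoc]
    exact ENNReal.tsum_comp_le_tsum_of_injective (add_right_injective d)
      fun t => survive p π x0 (m + t)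
  refine ENNReal.tendsto_atTop_zero.2 fun ε hε => ?_
  by_contra! hcon
  have hbad : ∀ k, ∃ π ∈ Λ, ε < ∑' t, survive p π x0 (k + t) := by
    intro k
    obtain ⟨n, hkn, hn⟩ := hcon k
    obtain ⟨π, hπ, hlt⟩ : ∃ π ∈ Λ, ε < ∑' t, survive p π x0 (n + t) := by
      simpa only [lt_iSup_iff, exists_prop] using hn
    exact ⟨π, hπ, hlt.trans_le (htail π hkn)⟩
  choose π hπ hlt using hbad
  let U : Ultrafilter ℕ := hyperfilter ℕ
  have hUtop : (U : Filter ℕ) ≤ atTop := Nat.hyperfilter_le_atTop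
  obtain ⟨π', -, hocc⟩ := exists_tendsto_lintegral_occupation habs hcomp U hπ
  obtain ⟨q, hq, hq0, hqs, hlim⟩ := exists_pairLaw_limit p hS U π x0
  have hr := fun n => tendsto_lintegral_comap_inl (hlim n)
  have hfin : IsFiniteMeasure (occupation p π' x0) := ⟨by rw [occupation_univ]; exact habs π'⟩
  have hle : Measure.sum (fun n => (q n).comap fun ya : Y × A => (Sum.inl ya.1, ya.2)) ≤
      occupation p π' x0 := by
    refine measure_le_of_forall_lintegral_le fun f => ?_
    rw [lintegral_sum_measure]
    refine ENNReal.tsum_le_of_sum_range_le fun N => ?_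
    refine le_of_tendsto_of_tendsto' (tendsto_finsetSum _ fun n _ => hr n f) (hocc f) fun k => ?_
    rw [occupation, lintegral_sum_measure]
    exact ENNReal.sum_le_tsum _
  have heq : (Measure.sum q).restrict (alive Y A) =
      (Measure.sum (pairLaw p π' x0)).restrict (alive Y A) := by
    refine sum_restrict_alive_eq_of_le hcem habs π' hq0 hqs ?_
    rw [← map_sum_comap_inl, ← map_sum_comap_inl]
    exact Measure.map_mono hle measurableEmbedding_inl_prodMk.measurable
  have htot : ∑' n, q n (alive Y A) = ∑' n, survive p π' x0 n := by
    have := congrArg (· Set.univ) heq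
    simpa only [Measure.restrict_apply_univ, Measure.sum_apply _ measurableSet_alive,
      ← survive_eq] using this
  have hhead : ∀ n, Tendsto (fun k => survive p (π k) x0 n) U (𝓝 (q n (alive Y A))) := by
    intro n
    simpa [survive_eq, measurableEmbedding_inl_prodMk.comap_apply, range_inl_prodMk]
      using hr n 1
  have htotal : Tendsto (fun k => ∑' t, survive p (π k) x0 t) U
      (𝓝 (∑' t, survive p π' x0 t)) := by
    simpa [occupation_univ] using hocc 1
  have hgap : ∀ N, ε + ∑ n ∈ Finset.range N, q n (alive Y A) ≤ ∑' t, survive p π' x0 t := by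
    intro N
    refine le_of_tendsto_of_tendsto
      (tendsto_const_nhds.add (tendsto_finsetSum _ fun n _ => hhead n)) htotal ?_
    filter_upwards [hUtop (eventually_ge_atTop N)] with k hk
    rw [← ENNReal.summable.sum_add_tsum_nat_add' (k := N), add_comm]
    gcongr
    simpa only [add_comm] using (hlt k).le.trans (htail (π k) hk)
  have hcontra : ε + ∑' t, survive p π' x0 t ≤ ∑' t, survive p π' x0 t := by
    conv_lhs => rw [← htot]
    exact le_of_tendsto' (tendsto_const_nhds.add (ENNReal.tendsto_nat_tsum _)) hgap
  exact (ENNReal.lt_add_right (habs π').ne hε.ne').not_ge (by rwa [add_comm])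

end
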